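/- arXiv:1303.6148 — 2 statements merged into one kernel-verified Lean document; each statement's English description precedes it below -/
import Mathlib

section
/- Let σ > 0 and let u : ℝ → (ℕ → ℂ) be a Fourier-side solution of the cubic Szegő equation. Suppose C₁ > 0 satisfies ‖u(t)‖_W + 1 ≤ C₁ for all t ∈ ℝ, and suppose ‖u(0)‖_{G_σ(W)} ≤ B < ∞. Define C₀ := max{B, ((1+√5)/2)·e·C₁} and λ := 4·C₀·C₁. Then for all t ∈ ℝ, ∑_{k∈ℕ} e^{σ·e^{−λ|t|}·k}·|u(t,k)| ≤ C₀. -/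
open scoped BigOperators

/-- The cubic nonlinearity of the Szegő equation on the Fourier side:
for frequency `k`, the sum of `u(t,n) * conj (u(t,j)) * u(t,m)` over all triples
`(n,j,m) ∈ ℕ³` with `n + m = j + k`. -/
noncomputable def szegoCubic (u : ℝ → ℕ → ℂ) (t : ℝ) (k : ℕ) : ℂ :=
  ∑' p : {p : ℕ × ℕ × ℕ // p.1 + p.2.2 = p.2.1 + k},
    u t p.1.1 * (starRingEnd ℂ) (u t p.1.2.1) * u t p.1.2.2

/-- `u : ℝ → (ℕ → ℂ)` is a Fourier-side solution of the cubic Szegő equation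
`i ∂ₜ u = Π(|u|² u)`. -/
def IsSzegoSolution (u : ℝ → ℕ → ℂ) : Prop :=
  ∀ t : ℝ, ∀ k : ℕ,
    (Summable fun p : {p : ℕ × ℕ × ℕ // p.1 + p.2.2 = p.2.1 + k} =>
      ‖u t p.1.1 * (starRingEnd ℂ) (u t p.1.2.1) * u t p.1.2.2‖) ∧
    HasDerivAt (fun s : ℝ => u s k) (-Complex.I * szegoCubic u t k) t

open Filter Topology

/-- The triples `(n, j, m)` interacting at frequency `k`, i.e. with `n + m = j + k`. -/
def szegoTriples (k : ℕ) : Set (ℕ × ℕ × ℕ) := {p | p.1 + p.2.2 = p.2.1 + k}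

theorem sum_weight_mul_tsum_szegoTriples_le {w a : ℕ → ℝ} (hw0 : ∀ k, 0 ≤ w k)
    (hw : ∀ n m k, k ≤ n + m → w k ≤ w n * w m) (ha0 : ∀ k, 0 ≤ a k) (ha : Summable a)
    (hwa : Summable fun k => w k * a k) (K : ℕ) :
    ∑ k ∈ Finset.range K, w k * ∑' p : szegoTriples k, a p.1.1 * a p.1.2.1 * a p.1.2.2 ≤
      (∑' k, a k) * (∑' k, w k * a k) ^ 2 := by
  have hwa0 : ∀ k, 0 ≤ w k * a k := fun k => mul_nonneg (hw0 k) (ha0 k)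
  set f : ℕ × ℕ × ℕ → ℝ := fun p => (w p.1 * a p.1) * (a p.2.1 * (w p.2.2 * a p.2.2)) with hf
  set g : ℕ × ℕ × ℕ → ℝ := fun p => a p.1 * a p.2.1 * a p.2.2
  have hf0 : ∀ p, 0 ≤ f p := fun p =>
    mul_nonneg (hwa0 _) (mul_nonneg (ha0 _) (hwa0 _))
  have hg0 : ∀ p, 0 ≤ g p := fun p => mul_nonneg (mul_nonneg (ha0 _) (ha0 _)) (ha0 _)
  have hinner : Summable fun q : ℕ × ℕ => a q.1 * (w q.2 * a q.2) :=
    ha.mul_of_nonneg hwa ha0 hwa0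
  have hfs : Summable f :=
    hwa.mul_of_nonneg hinner hwa0 fun q => mul_nonneg (ha0 _) (hwa0 _)
  have hgs : Summable g := by
    have h := ha.mul_of_nonneg (ha.mul_of_nonneg ha ha0 ha0) ha0
      (fun q => mul_nonneg (ha0 _) (ha0 _))
    simpa only [g, mul_assoc] using h
  have hfsum : ∑' p, f p = (∑' k, a k) * (∑' k, w k * a k) ^ 2 := by
    rw [hf, ← hwa.tsum_mul_tsum hinner hfs, ← ha.tsum_mul_tsum hwa hinner]
    ring
  have hstep : ∀ k, w k * ∑' p : szegoTriples k, g p ≤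
      ∑' p, (szegoTriples k).indicator f p := by
    intro k
    rw [← tsum_subtype, ← tsum_mul_left]
    refine Summable.tsum_le_tsum (fun p => ?_) ((hgs.subtype _).mul_left _) (hfs.subtype _)
    have hp : p.1.1 + p.1.2.2 = p.1.2.1 + k := p.2
    have h := mul_le_mul_of_nonneg_right (hw p.1.1 p.1.2.2 k (by omega)) (hg0 p)
    refine h.trans (le_of_eq ?_)
    simp only [f, g]
    ring
  calc
    _ ≤ ∑ k ∈ Finset.range K, ∑' p, (szegoTriples k).indicator f p :=
      Finset.sum_le_sum fun k _ => hstep k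
    _ = ∑' p, ∑ k ∈ Finset.range K, (szegoTriples k).indicator f p :=
      (Summable.tsum_finsetSum fun k _ => hfs.indicator _).symm
    _ ≤ ∑' p, f p := by
      refine Summable.tsum_le_tsum (fun p => ?_)
        (summable_sum fun k _ => hfs.indicator _) hfs
      calc
        _ ≤ ∑ k ∈ Finset.range K, if k = p.1 + p.2.2 - p.2.1 then f p else 0 := by
          refine Finset.sum_le_sum fun k _ => Set.indicator_apply_le' (fun hp => ?_) fun _ => ?_
          · have hp' : p.1 + p.2.2 = p.2.1 + k := hp
            rw [if_pos (by omega)]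
          · split_ifs <;> simp [hf0]
        _ ≤ f p := by
          rw [Finset.sum_ite_eq']
          split_ifs <;> simp [hf0]
    _ = _ := hfsum

/-- Mean value inequality for a finite weighted `ℓ¹` norm. -/
theorem sum_weight_mul_norm_sub_le {w : ℕ → ℝ} (hw0 : ∀ k, 0 ≤ w k) {u d : ℝ → ℕ → ℂ}
    (hd : ∀ s k, HasDerivAt (fun t => u t k) (d s k) s) {x z C : ℝ} (K : ℕ)
    (hC : ∀ s ∈ Set.uIcc x z, ∑ k ∈ Finset.range K, w k * ‖d s k‖ ≤ C) :
    ∑ k ∈ Finset.range K, w k * ‖u z k - u x k‖ ≤ C * |z - x| := by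
  have hphase : ∀ c : ℂ, ∃ θ : ℂ, ‖θ‖ ≤ 1 ∧ θ * c = ‖c‖ := by
    intro c
    by_cases hc : c = 0
    · exact ⟨0, by simp, by simp [hc]⟩
    · have hn : (‖c‖ : ℂ) ≠ 0 := by simpa using hc
      refine ⟨‖c‖ / c, ?_, by field_simp⟩
      simp [hc]
  choose θ hθ hθc using fun k => hphase (u z k - u x k)
  have hderiv : ∀ s, HasDerivAt (fun t => ∑ k ∈ Finset.range K, (w k : ℂ) * θ k * u t k)
      (∑ k ∈ Finset.range K, (w k : ℂ) * θ k * d s k) s := fun s =>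
    HasDerivAt.fun_sum fun k _ => (hd s k).const_mul _
  have hbound : ∀ s ∈ Set.uIcc x z, ‖∑ k ∈ Finset.range K, (w k : ℂ) * θ k * d s k‖ ≤ C := by
    intro s hs
    refine (norm_sum_le _ _).trans ((Finset.sum_le_sum fun k _ => ?_).trans (hC s hs))
    rw [norm_mul, norm_mul, Complex.norm_of_nonneg (hw0 k)]
    exact mul_le_mul_of_nonneg_right (mul_le_of_le_one_right (hw0 k) (hθ k)) (norm_nonneg _)
  have h := (convex_uIcc x z).norm_image_sub_le_of_norm_hasDerivWithin_le
    (fun s _ => (hderiv s).hasDerivWithinAt) hbound Set.left_mem_uIcc Set.right_mem_uIcc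
  have heq : (∑ k ∈ Finset.range K, (w k : ℂ) * θ k * u z k) -
      ∑ k ∈ Finset.range K, (w k : ℂ) * θ k * u x k =
      ((∑ k ∈ Finset.range K, w k * ‖u z k - u x k‖ : ℝ) : ℂ) := by
    rw [← Finset.sum_sub_distrib]
    push_cast
    refine Finset.sum_congr rfl fun k _ => ?_
    rw [← hθc k]
    ring
  rw [heq, Complex.norm_of_nonneg
    (Finset.sum_nonneg fun k _ => mul_nonneg (hw0 k) (norm_nonneg _)), Real.norm_eq_abs] at h
  exact h

/-- The exponential weight `e^{τ min(k, N)}`. -/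
noncomputable def cappedWeight (N : ℕ) (τ : ℝ) (k : ℕ) : ℝ := Real.exp (τ * (min k N : ℕ))

theorem cappedWeight_nonneg (N : ℕ) (τ : ℝ) (k : ℕ) : 0 ≤ cappedWeight N τ k :=
  (Real.exp_pos _).le

theorem cappedWeight_le_mul (N : ℕ) {τ : ℝ} (hτ : 0 ≤ τ) (n m k : ℕ) (h : k ≤ n + m) :
    cappedWeight N τ k ≤ cappedWeight N τ n * cappedWeight N τ m := by
  rw [cappedWeight, cappedWeight, cappedWeight, ← Real.exp_add, ← mul_add]
  refine Real.exp_le_exp.2 (mul_le_mul_of_nonneg_left ?_ hτ)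
  exact_mod_cast (by omega : min k N ≤ min n N + min m N)

theorem cappedWeight_le_exp (N : ℕ) {τ : ℝ} (hτ : 0 ≤ τ) (k : ℕ) :
    cappedWeight N τ k ≤ Real.exp (τ * k) :=
  Real.exp_le_exp.2 (mul_le_mul_of_nonneg_left (by exact_mod_cast min_le_left k N) hτ)

/-- The Gevrey weight decreases at a definite rate, up to a Wiener-norm error. -/
theorem cappedWeight_sub_le (N : ℕ) {σ lam : ℝ} (hσ : 0 ≤ σ) (hlam : 0 ≤ lam) {x z : ℝ}
    (hxz : x ≤ z) (k : ℕ) :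
    cappedWeight N (σ * Real.exp (-lam * z)) k - cappedWeight N (σ * Real.exp (-lam * x)) k ≤
      -lam * (z - x) * (cappedWeight N (σ * Real.exp (-lam * z)) k - Real.exp 1) := by
  simp only [cappedWeight]
  set p := σ * Real.exp (-lam * z) * (min k N : ℕ) with hp
  have hp0 : 0 ≤ p := by positivity
  have hq : σ * Real.exp (-lam * x) * (min k N : ℕ) = Real.exp (lam * (z - x)) * p := by
    rw [hp, show -lam * x = lam * (z - x) + -lam * z by ring, Real.exp_add]
    ring
  rw [hq]
  have hh : 0 ≤ lam * (z - x) := mul_nonneg hlam (sub_nonneg.2 hxz)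
  have h1 : lam * (z - x) * p ≤ Real.exp (lam * (z - x)) * p - p := by
    nlinarith [mul_le_mul_of_nonneg_right (Real.add_one_le_exp (lam * (z - x))) hp0]
  have h2 : Real.exp p * (lam * (z - x) * p) ≤
      Real.exp (Real.exp (lam * (z - x)) * p) - Real.exp p := by
    have h := Real.add_one_le_exp (Real.exp (lam * (z - x)) * p - p)
    have he := Real.exp_pos p
    rw [Real.exp_sub, le_div_iff₀ he] at h
    nlinarith [mul_le_mul_of_nonneg_left h1 he.le]
  have h3 : Real.exp p - Real.exp 1 ≤ p * Real.exp p := by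
    rcases le_total p 1 with h | h
    · have := Real.exp_le_exp.2 h
      have : 0 ≤ p * Real.exp p := by positivity
      linarith
    · nlinarith [Real.exp_pos p, Real.exp_pos 1]
  nlinarith [mul_le_mul_of_nonneg_left h3 hh]

theorem summable_cappedWeight_mul (N : ℕ) (τ : ℝ) {a : ℕ → ℝ} (ha : Summable a) :
    Summable fun k => cappedWeight N τ k * a k := by
  rw [← summable_nat_add_iff N] at ha ⊢
  refine (ha.mul_left (Real.exp (τ * N))).congr fun k => ?_
  simp [cappedWeight]

theorem tsum_cappedWeight_mul (N : ℕ) (τ : ℝ) {a : ℕ → ℝ} (ha : Summable a) :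
    ∑' k, cappedWeight N τ k * a k =
      ∑ k ∈ Finset.range N, (cappedWeight N τ k - Real.exp (τ * N)) * a k +
        Real.exp (τ * N) * ∑' k, a k := by
  rw [← (summable_cappedWeight_mul N τ ha).sum_add_tsum_nat_add N, ← ha.sum_add_tsum_nat_add N,
    mul_add, Finset.mul_sum, ← add_assoc, ← Finset.sum_add_distrib, ← tsum_mul_left]
  congr 1
  · exact Finset.sum_congr rfl fun k _ => by ring
  · exact tsum_congr fun k => by simp [cappedWeight]

/-- A family of coefficients whose time derivatives are dominated by the cubic Szegő
interaction. This is implied by the Szegő equation and invariant under time reversal. -/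
def IsSzegoDominated (u d : ℝ → ℕ → ℂ) : Prop :=
  ∀ s k, HasDerivAt (fun t => u t k) (d s k) s ∧
    ‖d s k‖ ≤ ∑' p : szegoTriples k, ‖u s p.1.1‖ * ‖u s p.1.2.1‖ * ‖u s p.1.2.2‖

theorem IsSzegoSolution.isSzegoDominated {u : ℝ → ℕ → ℂ} (hu : IsSzegoSolution u) :
    IsSzegoDominated u fun s k => -Complex.I * szegoCubic u s k := by
  intro s k
  refine ⟨(hu s k).2, ?_⟩
  rw [norm_mul, norm_neg, Complex.norm_I, one_mul]
  refine (norm_tsum_le_tsum_norm (hu s k).1).trans (le_of_eq (tsum_congr fun p => ?_))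
  rw [norm_mul, norm_mul, RCLike.norm_conj]

namespace IsSzegoDominated

variable {u d : ℝ → ℕ → ℂ}

theorem comp_neg (hu : IsSzegoDominated u d) :
    IsSzegoDominated (fun t => u (-t)) fun t k => -d (-t) k := by
  intro s k
  refine ⟨?_, by simpa only [norm_neg] using (hu (-s) k).2⟩
  have h := (hu (-s) k).1.scomp s (hasDerivAt_neg s)
  rw [neg_one_smul] at h
  exact h

theorem sum_weight_mul_norm_deriv_le (hu : IsSzegoDominated u d)
    (hW : ∀ t, Summable fun k => ‖u t k‖) {w : ℕ → ℝ} (hw0 : ∀ k, 0 ≤ w k)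
    (hw : ∀ n m k, k ≤ n + m → w k ≤ w n * w m) (s : ℝ)
    (hws : Summable fun k => w k * ‖u s k‖) (K : ℕ) :
    ∑ k ∈ Finset.range K, w k * ‖d s k‖ ≤ (∑' k, ‖u s k‖) * (∑' k, w k * ‖u s k‖) ^ 2 :=
  (Finset.sum_le_sum fun k _ => mul_le_mul_of_nonneg_left (hu s k).2 (hw0 k)).trans
    (sum_weight_mul_tsum_szegoTriples_le hw0 hw (fun k => norm_nonneg (u s k)) (hW s) hws K)

/-- Local growth bound for a submultiplicatively weighted Wiener norm. -/
theorem tsum_weight_mul_norm_le (hu : IsSzegoDominated u d)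
    (hW : ∀ t, Summable fun k => ‖u t k‖) {w : ℕ → ℝ} (hw0 : ∀ k, 0 ≤ w k)
    (hw : ∀ n m k, k ≤ n + m → w k ≤ w n * w m)
    (hws : ∀ s, Summable fun k => w k * ‖u s k‖) {x z M Q : ℝ}
    (hM : ∀ s ∈ Set.uIcc x z, ∑' k, ‖u s k‖ ≤ M)
    (hQ : ∀ s ∈ Set.uIcc x z, ∑' k, w k * ‖u s k‖ ≤ Q) :
    ∑' k, w k * ‖u z k‖ ≤ ∑' k, w k * ‖u x k‖ + M * Q ^ 2 * |z - x| := by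
  have hM0 : 0 ≤ M := (tsum_nonneg fun k => norm_nonneg _).trans (hM x Set.left_mem_uIcc)
  refine le_of_tendsto' (hws z).hasSum.tendsto_sum_nat fun K => ?_
  have hC : ∀ s ∈ Set.uIcc x z, ∑ k ∈ Finset.range K, w k * ‖d s k‖ ≤ M * Q ^ 2 := fun s hs =>
    (hu.sum_weight_mul_norm_deriv_le hW hw0 hw s (hws s) K).trans
      (mul_le_mul (hM s hs) (pow_le_pow_left₀
        (tsum_nonneg fun k => mul_nonneg (hw0 k) (norm_nonneg _)) (hQ s hs) 2)
        (sq_nonneg _) hM0)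
  have h := sum_weight_mul_norm_sub_le hw0 (fun s k => (hu s k).1) K hC
  have hx := (hws x).sum_le_tsum (Finset.range K) fun k _ => mul_nonneg (hw0 k) (norm_nonneg _)
  have htri : ∑ k ∈ Finset.range K, w k * ‖u z k‖ ≤ ∑ k ∈ Finset.range K, w k * ‖u x k‖ +
      ∑ k ∈ Finset.range K, w k * ‖u z k - u x k‖ := by
    rw [← Finset.sum_add_distrib]
    refine Finset.sum_le_sum fun k _ => ?_
    rw [← mul_add]
    exact mul_le_mul_of_nonneg_left (norm_le_norm_add_norm_sub' _ _) (hw0 k)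
  linarith

theorem continuous_tsum_norm (hu : IsSzegoDominated u d) (hW : ∀ t, Summable fun k => ‖u t k‖)
    {M : ℝ} (hM : ∀ t, ∑' k, ‖u t k‖ ≤ M) : Continuous fun t => ∑' k, ‖u t k‖ := by
  have hM0 : 0 ≤ M := (tsum_nonneg fun k => norm_nonneg _).trans (hM 0)
  refine (LipschitzWith.of_le_add_mul (M * M ^ 2).toNNReal fun z x => ?_).continuous
  have h := hu.tsum_weight_mul_norm_le hW (w := fun _ => 1) (x := x) (z := z) (M := M) (Q := M)
    (fun _ => zero_le_one) (fun _ _ _ _ => by simp) (fun s => by simpa using hW s)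
    (fun s _ => hM s) (fun s _ => by simpa using hM s)
  rw [Real.coe_toNNReal _ (by positivity), Real.dist_eq]
  simpa using h

theorem continuous_tsum_cappedWeight (hu : IsSzegoDominated u d)
    (hW : ∀ t, Summable fun k => ‖u t k‖) {M : ℝ} (hM : ∀ t, ∑' k, ‖u t k‖ ≤ M) (N : ℕ)
    {τ : ℝ → ℝ} (hτ : Continuous τ) :
    Continuous fun t => ∑' k, cappedWeight N (τ t) k * ‖u t k‖ := by
  have hc := hu.continuous_tsum_norm hW hM
  have huc : ∀ k, Continuous fun t => u t k := fun k =>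
    continuous_iff_continuousAt.2 fun t => (hu t k).1.continuousAt
  rw [funext fun t => tsum_cappedWeight_mul N (τ t) (hW t)]
  unfold cappedWeight
  fun_prop

theorem tsum_cappedWeight_le (hu : IsSzegoDominated u d)
    (hW : ∀ t, Summable fun k => ‖u t k‖) {σ M C : ℝ} (hσ : 0 ≤ σ) (hM0 : 0 < M)
    (hM : ∀ t, ∑' k, ‖u t k‖ ≤ M) (hMC : 4 * Real.exp 1 * M < 3 * C) (N : ℕ)
    (h0 : ∑' k, cappedWeight N σ k * ‖u 0 k‖ ≤ C) {t : ℝ} (ht : 0 ≤ t) :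
    ∑' k, cappedWeight N (σ * Real.exp (-(4 * C * M) * t)) k * ‖u t k‖ ≤ C := by
  have hC : 0 < C := by nlinarith [mul_pos (Real.exp_pos 1) hM0]
  set lam := 4 * C * M with hlam
  have hlam0 : 0 ≤ lam := by positivity
  set F : ℝ → ℝ := fun s => ∑' k, cappedWeight N (σ * Real.exp (-lam * s)) k * ‖u s k‖ with hF
  have hFc : Continuous F := hu.continuous_tsum_cappedWeight hW hM N (by fun_prop)
  refine image_le_of_liminf_slope_right_lt_deriv_boundary (f := F) (B := fun _ => C)
    (B' := fun _ => 0) (f' := fun s => -lam * (F s - Real.exp 1 * M) + M * F s ^ 2)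
    (a := 0) (b := t) hFc.continuousOn ?_ (by simpa [hF] using h0)
    (fun s => hasDerivAt_const s C) ?_ (Set.right_mem_Icc.2 ht)
  · intro x _ r hr
    refine Eventually.frequently ?_
    set τ := σ * Real.exp (-lam * x)
    have hτ0 : 0 ≤ τ := by positivity
    obtain ⟨Q, hQr, hQ⟩ : ∃ Q, -lam * (F x - Real.exp 1 * M) + M * Q ^ 2 < r ∧ F x < Q := by
      have hq : ContinuousAt (fun q => -lam * (F x - Real.exp 1 * M) + M * q ^ 2) (F x) := by
        fun_prop
      exact (((hq.eventually_lt_const hr).filter_mono nhdsWithin_le_nhds).and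
        (self_mem_nhdsWithin : Set.Ioi (F x) ∈ 𝓝[>] (F x))).exists
    have hGc := hu.continuous_tsum_cappedWeight hW hM N (continuous_const (y := τ))
    have hG : ∀ᶠ s in 𝓝 x, ∑' k, cappedWeight N τ k * ‖u s k‖ < Q :=
      hGc.continuousAt.eventually_lt_const hQ
    obtain ⟨δ, hδ, hball⟩ := Metric.eventually_nhds_iff.1 hG
    have hFr : ∀ᶠ z in 𝓝 x, -lam * (F z - Real.exp 1 * M) + M * Q ^ 2 < r := by
      have hc : Continuous fun z => -lam * (F z - Real.exp 1 * M) + M * Q ^ 2 := by fun_prop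
      exact hc.continuousAt.eventually_lt_const hQr
    filter_upwards [self_mem_nhdsWithin, nhdsWithin_le_nhds hFr,
      nhdsWithin_le_nhds (Metric.ball_mem_nhds x hδ)] with z hxz hz hzδ
    have hxz' : 0 < z - x := sub_pos.2 hxz
    refine lt_of_le_of_lt ?_ hz
    rw [slope_def_field, div_le_iff₀ hxz']
    have hgrow := hu.tsum_weight_mul_norm_le hW (cappedWeight_nonneg N τ)
      (cappedWeight_le_mul N hτ0) (fun s => summable_cappedWeight_mul N τ (hW s))
      (x := x) (z := z) (M := M) (Q := Q) (fun s _ => hM s) (fun s hs => by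
        refine (hball ?_).le
        rw [dist_comm]
        exact (Real.dist_left_le_of_mem_uIcc hs).trans_lt (by rwa [dist_comm]))
    have hdecay : F z - ∑' k, cappedWeight N τ k * ‖u z k‖ ≤
        -lam * (z - x) * (F z - Real.exp 1 * ∑' k, ‖u z k‖) := by
      have hs1 := summable_cappedWeight_mul N (σ * Real.exp (-lam * z)) (hW z)
      have hs2 := summable_cappedWeight_mul N τ (hW z)
      have hs3 := (hW z).mul_left (Real.exp 1)
      rw [← tsum_mul_left, hF, ← hs1.tsum_sub hs2, ← hs1.tsum_sub hs3, ← tsum_mul_left]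
      refine (hs1.sub hs2).tsum_le_tsum (fun k => ?_) ((hs1.sub hs3).mul_left _)
      rw [← sub_mul, ← sub_mul, ← mul_assoc]
      exact mul_le_mul_of_nonneg_right (cappedWeight_sub_le N hσ hlam0 (le_of_lt hxz) k)
        (norm_nonneg _)
    rw [abs_of_pos hxz'] at hgrow
    have hWz : lam * (z - x) * (Real.exp 1 * ∑' k, ‖u z k‖) ≤
        lam * (z - x) * (Real.exp 1 * M) := by
      have := hM z
      gcongr
    have hFx : F x = ∑' k, cappedWeight N τ k * ‖u x k‖ := rfl
    linarith
  · intro s _ hs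
    rw [hs, hlam]
    nlinarith [mul_pos (mul_pos hC hM0) (sub_pos.2 hMC)]

theorem gevrey_bound (hu : IsSzegoDominated u d)
    (hW : ∀ t, Summable fun k => ‖u t k‖) {σ M C : ℝ} (hσ : 0 ≤ σ) (hM0 : 0 < M)
    (hM : ∀ t, ∑' k, ‖u t k‖ ≤ M) (hMC : 4 * Real.exp 1 * M < 3 * C)
    (hG : Summable fun k : ℕ => Real.exp (σ * k) * ‖u 0 k‖)
    (h0 : ∑' k : ℕ, Real.exp (σ * k) * ‖u 0 k‖ ≤ C) {t : ℝ} (ht : 0 ≤ t) :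
    (Summable fun k : ℕ => Real.exp (σ * Real.exp (-(4 * C * M) * t) * k) * ‖u t k‖) ∧
      ∑' k : ℕ, Real.exp (σ * Real.exp (-(4 * C * M) * t) * k) * ‖u t k‖ ≤ C := by
  have hcap : ∀ N, ∑' k, cappedWeight N σ k * ‖u 0 k‖ ≤ C := fun N =>
    ((summable_cappedWeight_mul N σ (hW 0)).tsum_le_tsum (fun k =>
      mul_le_mul_of_nonneg_right (cappedWeight_le_exp N hσ k) (norm_nonneg _)) hG).trans h0
  have hpart : ∀ N, ∑ k ∈ Finset.range N,
      Real.exp (σ * Real.exp (-(4 * C * M) * t) * k) * ‖u t k‖ ≤ C := by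
    intro N
    refine le_trans ?_ (hu.tsum_cappedWeight_le hW hσ hM0 hM hMC N (hcap N) ht)
    refine le_trans (le_of_eq (Finset.sum_congr rfl fun k hk => ?_))
      ((summable_cappedWeight_mul N _ (hW t)).sum_le_tsum (Finset.range N) fun k _ =>
        mul_nonneg (cappedWeight_nonneg N _ k) (norm_nonneg _))
    rw [cappedWeight, min_eq_left (Finset.mem_range.1 hk).le]
  have hnn : ∀ k : ℕ, 0 ≤ Real.exp (σ * Real.exp (-(4 * C * M) * t) * k) * ‖u t k‖ :=
    fun k => by positivity
  exact ⟨summable_of_sum_range_le hnn hpart, Real.tsum_le_of_sum_range_le hnn hpart⟩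

end IsSzegoDominated

/-- Quantitative Gevrey bound: with `‖u(t)‖_W + 1 ≤ C₁`,
`‖u(0)‖_{G_σ(W)} ≤ B`, `C₀ = max{B, ((1+√5)/2) e C₁}` and `λ = 4 C₀ C₁`, one has
`∑_k e^{σ e^{-λ|t|} k} |u(t,k)| ≤ C₀` for all `t`. -/
theorem szego_gevrey_bound (σ : ℝ) (hσ : 0 < σ) (u : ℝ → ℕ → ℂ)
    (hu : IsSzegoSolution u) (C₁ B : ℝ) (hC₁ : 0 < C₁)
    (hW : ∀ t : ℝ, Summable fun k : ℕ => ‖u t k‖)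
    (hWb : ∀ t : ℝ, (∑' k : ℕ, ‖u t k‖) + 1 ≤ C₁)
    (hG : Summable fun k : ℕ => Real.exp (σ * k) * ‖u 0 k‖)
    (hB : (∑' k : ℕ, Real.exp (σ * k) * ‖u 0 k‖) ≤ B)
    (C₀ lam : ℝ)
    (hC₀ : C₀ = max B ((1 + Real.sqrt 5) / 2 * Real.exp 1 * C₁))
    (hlam : lam = 4 * C₀ * C₁) :
    ∀ t : ℝ,
      (Summable fun k : ℕ => Real.exp (σ * Real.exp (-lam * |t|) * k) * ‖u t k‖) ∧
      (∑' k : ℕ, Real.exp (σ * Real.exp (-lam * |t|) * k) * ‖u t k‖) ≤ C₀ := by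
  have hM : ∀ t, ∑' k, ‖u t k‖ ≤ C₁ := fun t => by linarith [hWb t]
  have hMC : 4 * Real.exp 1 * C₁ < 3 * C₀ := by
    have h5 : (2 : ℝ) < Real.sqrt 5 := Real.lt_sqrt_of_sq_lt (by norm_num)
    have hle : (1 + Real.sqrt 5) / 2 * Real.exp 1 * C₁ ≤ C₀ := hC₀ ▸ le_max_right _ _
    nlinarith [mul_pos (Real.exp_pos 1) hC₁, mul_pos (mul_pos (Real.exp_pos 1) hC₁) (sub_pos.2 h5)]
  have h0 := hB.trans (hC₀ ▸ le_max_left _ _ : B ≤ C₀)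
  intro t
  rw [hlam]
  rcases le_total 0 t with ht | ht
  · rw [abs_of_nonneg ht]
    exact hu.isSzegoDominated.gevrey_bound hW hσ.le hC₁ hM hMC hG h0 ht
  · rw [abs_of_nonpos ht]
    have h := hu.isSzegoDominated.comp_neg.gevrey_bound (fun s => hW (-s)) hσ.le hC₁
      (fun s => hM (-s)) hMC (by simpa using hG) (by simpa using h0) (neg_nonneg.2 ht)
    simpa only [neg_neg] using h
end

section
/- Let σ > 0 and let u : ℝ → (ℕ → ℂ) be a Fourier-side solution of the cubic Szegő equation. Suppose C₁ > 0 satisfies ‖u(t)‖_W + 1 ≤ C₁ for all t ∈ ℝ, and suppose ‖u(0)‖_{G_σ(W)} ≤ B < ∞. Set C₀ := max{B, ((1+√5)/2)·e·C₁}. For t ≠ 0 define λ̃(t) := 2C₁·( 2B/(C₁|t|) + 5e²C₁² )^{1/2} + 2e·C₁² and τ̃(t) := σ·e^{−λ̃(t)·|t|}. Then for all t ≠ 0, ∑_{k∈ℕ} e^{τ̃(t)·k}·|u(t,k)| ≤ C₀. In particular λ̃(t) → 2(1+√5)·e·C₁² as |t| → ∞, so the exponential shrinking rate of the analyticity radius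 is asymptotically independent of the Gevrey norm of the initial datum. -/
open scoped BigOperators

/-- Weighted `ℓ¹` bound for the cubic convolution, for a weight which is submultiplicative along
`k ≤ n + m`. -/
theorem sum_mul_tsum_cubic_le {a w : ℕ → ℝ} (ha : ∀ k, 0 ≤ a k) (hw : ∀ k, 0 ≤ w k)
    (hsub : ∀ k n m, k ≤ n + m → w k ≤ w n * w m) (hs : Summable a)
    (hws : Summable fun k => w k * a k) (F : Finset ℕ) :
    ∑ k ∈ F, w k * ∑' p : {p : ℕ × ℕ × ℕ // p.1 + p.2.2 = p.2.1 + k},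
        a p.1.1 * a p.1.2.1 * a p.1.2.2 ≤
      (∑' k, a k) * (∑' k, w k * a k) ^ 2 := by
  have hwa : ∀ k, 0 ≤ w k * a k := fun k => mul_nonneg (hw k) (ha k)
  have hs₂ : Summable fun q : ℕ × ℕ => a q.1 * (w q.2 * a q.2) :=
    hs.mul_of_nonneg hws ha hwa
  have hs₃ : Summable fun p : ℕ × ℕ × ℕ => w p.1 * a p.1 * (a p.2.1 * (w p.2.2 * a p.2.2)) :=
    hws.mul_of_nonneg hs₂ hwa fun q => mul_nonneg (ha _) (hwa _)
  set g : ℕ × ℕ × ℕ → ℝ := fun p => w p.1 * a p.1 * (a p.2.1 * (w p.2.2 * a p.2.2)) with hg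
  have hg0 : ∀ p, 0 ≤ g p := fun p => mul_nonneg (hwa _) (mul_nonneg (ha _) (hwa _))
  have hgt : ∑' p, g p = (∑' k, a k) * (∑' k, w k * a k) ^ 2 := by
    rw [hg, ← hws.tsum_mul_tsum hs₂ hs₃, ← hs.tsum_mul_tsum hws hs₂]
    ring
  let ι : (Σ k : ℕ, {p : ℕ × ℕ × ℕ // p.1 + p.2.2 = p.2.1 + k}) → ℕ × ℕ × ℕ := fun x => x.2.1
  have hι : Function.Injective ι := by
    rintro ⟨k, p, hp⟩ ⟨l, q, hq⟩ (h : p = q)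
    subst h
    obtain rfl : k = l := by omega
    rfl
  have hgι : Summable (g ∘ ι) := hs₃.comp_injective hι
  have hterm : ∀ k, w k * ∑' p : {p : ℕ × ℕ × ℕ // p.1 + p.2.2 = p.2.1 + k},
      a p.1.1 * a p.1.2.1 * a p.1.2.2 ≤
      ∑' p : {p : ℕ × ℕ × ℕ // p.1 + p.2.2 = p.2.1 + k}, (g ∘ ι) ⟨k, p⟩ := by
    intro k
    rw [← tsum_mul_left]
    have hle : ∀ p : {p : ℕ × ℕ × ℕ // p.1 + p.2.2 = p.2.1 + k},
        w k * (a p.1.1 * a p.1.2.1 * a p.1.2.2) ≤ (g ∘ ι) ⟨k, p⟩ := by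
      rintro ⟨⟨n, j, m⟩, hp⟩
      simp only at hp
      have h := mul_le_mul_of_nonneg_right (hsub k n m (by omega))
        (mul_nonneg (mul_nonneg (ha n) (ha j)) (ha m))
      simp only [hg, ι, Function.comp]
      linarith
    refine Summable.tsum_le_tsum hle ?_ (hgι.sigma_factor k)
    exact (hgι.sigma_factor k).of_nonneg_of_le
      (fun p => mul_nonneg (hw k) (mul_nonneg (mul_nonneg (ha _) (ha _)) (ha _))) hle
  calc _ ≤ ∑ k ∈ F, ∑' p : {p : ℕ × ℕ × ℕ // p.1 + p.2.2 = p.2.1 + k}, (g ∘ ι) ⟨k, p⟩ :=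
        Finset.sum_le_sum fun k _ => hterm k
    _ ≤ ∑' k, ∑' p : {p : ℕ × ℕ × ℕ // p.1 + p.2.2 = p.2.1 + k}, (g ∘ ι) ⟨k, p⟩ :=
        hgι.sigma.sum_le_tsum F fun k _ => tsum_nonneg fun p => hg0 _
    _ = ∑' x, (g ∘ ι) x := hgι.tsum_sigma.symm
    _ ≤ ∑' p, g p := tsum_comp_le_tsum_of_inj hs₃ hg0 hι
    _ = _ := hgt

/-- Mean value inequality in a finite weighted `ℓ¹` norm. -/
theorem sum_mul_norm_sub_le {u v : ℝ → ℕ → ℂ}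
    (hd : ∀ t k, HasDerivAt (fun s => u s k) (v t k) t) {w : ℕ → ℝ} (hw : ∀ k, 0 ≤ w k)
    (F : Finset ℕ) {a b C : ℝ} (hab : a ≤ b)
    (hC : ∀ s ∈ Set.Icc a b, ∑ k ∈ F, w k * ‖v s k‖ ≤ C) :
    ∑ k ∈ F, w k * ‖u b k - u a k‖ ≤ C * (b - a) := by
  have hphase : ∀ z : ℂ, ∃ c : ℂ, ‖c‖ ≤ 1 ∧ c * z = ‖z‖ := fun z => by
    rcases eq_or_ne z 0 with rfl | hz
    · exact ⟨0, by simp⟩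
    · refine ⟨(starRingEnd ℂ) z / ‖z‖, ?_, ?_⟩
      · simp [hz]
      · have : (‖z‖ : ℂ) ≠ 0 := by simpa using hz
        rw [div_mul_eq_mul_div, mul_comm, Complex.mul_conj, Complex.normSq_eq_norm_sq]
        push_cast
        field_simp
  choose c hc1 hc using fun k => hphase (u b k - u a k)
  have hder : ∀ s, HasDerivAt (fun s => ∑ k ∈ F, (w k : ℂ) * c k * u s k)
      (∑ k ∈ F, (w k : ℂ) * c k * v s k) s := fun s =>
    HasDerivAt.fun_sum fun k _ => (hd s k).const_mul _
  have hmv := norm_image_sub_le_of_norm_deriv_le_segment' (a := a) (b := b) (C := C)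
    (fun s _ => (hder s).hasDerivWithinAt) (fun s hs => by
      refine (norm_sum_le _ _).trans (le_trans (Finset.sum_le_sum fun k _ => ?_)
        (hC s ⟨hs.1, hs.2.le⟩))
      rw [norm_mul, norm_mul, Complex.norm_of_nonneg (hw k)]
      exact mul_le_mul_of_nonneg_right (mul_le_of_le_one_right (hw k) (hc1 k)) (norm_nonneg _))
    b (Set.right_mem_Icc.2 hab)
  refine le_trans (le_of_eq ?_) hmv
  have : (∑ k ∈ F, (w k : ℂ) * c k * u b k) - ∑ k ∈ F, (w k : ℂ) * c k * u a k =
      ((∑ k ∈ F, w k * ‖u b k - u a k‖ : ℝ) : ℂ) := by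
    rw [← Finset.sum_sub_distrib]
    push_cast
    refine Finset.sum_congr rfl fun k _ => ?_
    rw [← mul_sub, mul_assoc, hc]
  rw [this, Complex.norm_of_nonneg]
  exact Finset.sum_nonneg fun k _ => mul_nonneg (hw k) (norm_nonneg _)

/-- A trajectory whose Fourier coefficients move with velocity `v`, where `v` is dominated by the
cubic convolution of the trajectory, and whose Wiener norm stays below `W`. -/
structure IsCubicFlow (u v : ℝ → ℕ → ℂ) (W : ℝ) : Prop where
  hasDerivAt : ∀ t k, HasDerivAt (fun s => u s k) (v t k) t
  summable : ∀ t, Summable fun k => ‖u t k‖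
  tsum_le : ∀ t, ∑' k, ‖u t k‖ ≤ W
  norm_le : ∀ t k, ‖v t k‖ ≤ ∑' p : {p : ℕ × ℕ × ℕ // p.1 + p.2.2 = p.2.1 + k},
    ‖u t p.1.1‖ * ‖u t p.1.2.1‖ * ‖u t p.1.2.2‖

theorem Summable.bounded_mul {a w : ℕ → ℝ} {M : ℝ} (hs : Summable a) (ha : ∀ k, 0 ≤ a k)
    (hw : ∀ k, 0 ≤ w k) (hM : ∀ k, w k ≤ M) : Summable fun k => w k * a k :=
  (hs.mul_left M).of_nonneg_of_le (fun k => mul_nonneg (hw k) (ha k))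
    fun k => mul_le_mul_of_nonneg_right (hM k) (ha k)

namespace IsCubicFlow

variable {u v : ℝ → ℕ → ℂ} {W : ℝ}

theorem nonneg (h : IsCubicFlow u v W) : 0 ≤ W :=
  (tsum_nonneg fun _ => norm_nonneg _).trans (h.tsum_le 0)

theorem summable_weight (h : IsCubicFlow u v W) {w : ℕ → ℝ} {M : ℝ} (hw : ∀ k, 0 ≤ w k)
    (hM : ∀ k, w k ≤ M) (t : ℝ) : Summable fun k => w k * ‖u t k‖ :=
  (h.summable t).bounded_mul (fun _ => norm_nonneg _) hw hM

theorem summable_sub (h : IsCubicFlow u v W) (a b : ℝ) : Summable fun k => ‖u b k - u a k‖ :=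
  ((h.summable b).add (h.summable a)).of_nonneg_of_le (fun _ => norm_nonneg _)
    fun _ => norm_sub_le _ _

theorem summable_weight_sub (h : IsCubicFlow u v W) {w : ℕ → ℝ} {M : ℝ} (hw : ∀ k, 0 ≤ w k)
    (hM : ∀ k, w k ≤ M) (a b : ℝ) : Summable fun k => w k * ‖u b k - u a k‖ :=
  (h.summable_sub a b).bounded_mul (fun _ => norm_nonneg _) hw hM

theorem tsum_weight_sub_le (h : IsCubicFlow u v W) {w : ℕ → ℝ} {M : ℝ} (hw : ∀ k, 0 ≤ w k)
    (hM : ∀ k, w k ≤ M) (hsub : ∀ k n m, k ≤ n + m → w k ≤ w n * w m) {a b Q : ℝ} (hab : a ≤ b)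
    (hQ : ∀ s ∈ Set.Icc a b, ∑' k, w k * ‖u s k‖ ≤ Q) :
    ∑' k, w k * ‖u b k - u a k‖ ≤ W * Q ^ 2 * (b - a) := by
  refine (h.summable_weight_sub hw hM a b).tsum_le_of_sum_le fun F => ?_
  refine sum_mul_norm_sub_le h.hasDerivAt hw F hab fun s hs => ?_
  have h0 : 0 ≤ ∑' k, w k * ‖u s k‖ := tsum_nonneg fun k => mul_nonneg (hw k) (norm_nonneg _)
  calc _ ≤ _ := Finset.sum_le_sum fun k _ => mul_le_mul_of_nonneg_left (h.norm_le s k) (hw k)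
    _ ≤ _ := sum_mul_tsum_cubic_le (fun _ => norm_nonneg _) hw hsub (h.summable s)
        (h.summable_weight hw hM s) F
    _ ≤ W * Q ^ 2 := mul_le_mul (h.tsum_le s) (pow_le_pow_left₀ h0 (hQ s hs) 2) (sq_nonneg _)
        h.nonneg

theorem abs_tsum_weight_sub_le (h : IsCubicFlow u v W) {w : ℕ → ℝ} {M : ℝ} (hw : ∀ k, 0 ≤ w k)
    (hM : ∀ k, w k ≤ M) {a b : ℝ} (hab : a ≤ b) :
    |(∑' k, w k * ‖u b k‖) - ∑' k, w k * ‖u a k‖| ≤ M * W ^ 3 * (b - a) := by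
  have h1 : ∑' k, ‖u b k - u a k‖ ≤ W * W ^ 2 * (b - a) := by
    simpa using h.tsum_weight_sub_le (w := fun _ => 1) (M := 1) (Q := W) (fun _ => zero_le_one)
      (fun _ => le_rfl) (by simp) hab (fun s _ => by simpa using h.tsum_le s)
  have hM0 : 0 ≤ M := (hw 0).trans (hM 0)
  have hle : ∀ k, ‖w k * ‖u b k‖ - w k * ‖u a k‖‖ ≤ M * ‖u b k - u a k‖ := fun k => by
    rw [← mul_sub, norm_mul, Real.norm_of_nonneg (hw k), Real.norm_eq_abs]
    exact mul_le_mul (hM k) (abs_norm_sub_norm_le _ _) (abs_nonneg _) hM0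
  rw [← (h.summable_weight hw hM b).tsum_sub (h.summable_weight hw hM a), ← Real.norm_eq_abs]
  refine (tsum_of_norm_bounded ((h.summable_sub a b).mul_left M).hasSum hle).trans ?_
  rw [tsum_mul_left]
  nlinarith [mul_le_mul_of_nonneg_left h1 hM0]

theorem continuous_tsum_weight (h : IsCubicFlow u v W) {w : ℕ → ℝ} {M : ℝ} (hw : ∀ k, 0 ≤ w k)
    (hM : ∀ k, w k ≤ M) : Continuous fun t => ∑' k, w k * ‖u t k‖ := by
  have hC : 0 ≤ M * W ^ 3 := mul_nonneg ((hw 0).trans (hM 0)) (pow_nonneg h.nonneg 3)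
  refine (LipschitzWith.of_dist_le_mul (K := ⟨M * W ^ 3, hC⟩) fun s t => ?_).continuous
  rw [Real.dist_eq, Real.dist_eq]
  change _ ≤ M * W ^ 3 * |s - t|
  rcases le_total s t with hst | hst
  · rw [abs_sub_comm, abs_sub_comm s, abs_of_nonneg (sub_nonneg.2 hst)]
    exact h.abs_tsum_weight_sub_le hw hM hst
  · rw [abs_of_nonneg (sub_nonneg.2 hst)]
    exact h.abs_tsum_weight_sub_le hw hM hst

end IsCubicFlow

theorem tsum_comp_min_mul {a : ℕ → ℝ} (hs : Summable a) (ha : ∀ k, 0 ≤ a k) (N : ℕ) (φ : ℕ → ℝ) :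
    ∑' k, φ (min k N) * a k =
      ∑ m ∈ Finset.range (N + 1), φ m * ∑' k, (if min k N = m then 1 else 0) * a k := by
  have hsum : ∀ m, Summable fun k => (if min k N = m then (1 : ℝ) else 0) * a k := fun m =>
    hs.bounded_mul (M := 1) ha (fun k => by split_ifs <;> norm_num)
      (fun k => by split_ifs <;> norm_num)
  simp_rw [← tsum_mul_left]
  rw [← Summable.tsum_finsetSum fun m _ => (hsum m).mul_left (φ m)]
  refine tsum_congr fun k => ?_
  rw [Finset.sum_eq_single (min k N)]
  · simp
  · intro m _ hm
    simp [hm.symm]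
  · intro hk
    simp at hk

theorem two_mul_exp_sub_le (x : ℝ) : 2 * Real.exp x - Real.exp 1 ≤ x * Real.exp x := by
  have h1 : Real.exp 1 = Real.exp (1 - x) * Real.exp x := by rw [← Real.exp_add]; ring_nf
  nlinarith [Real.add_one_le_exp (1 - x), Real.exp_pos x]

namespace IsCubicFlow

variable {u v : ℝ → ℕ → ℂ} {W : ℝ}

theorem tsum_truncated_le (h : IsCubicFlow u v W) {C K l σ : ℝ} (hWC : W < C)
    (hK : Real.exp 1 * C ≤ K) (hl : C * K ≤ l) (hσ : 0 ≤ σ)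
    (hs0 : Summable fun k : ℕ => Real.exp (σ * k) * ‖u 0 k‖)
    (h0 : ∑' k : ℕ, Real.exp (σ * k) * ‖u 0 k‖ ≤ K) {T : ℝ} (hT : 0 ≤ T) (N : ℕ) :
    ∑' k, Real.exp (σ * Real.exp (-l * T) * (min k N : ℕ)) * ‖u T k‖ ≤ K := by
  have hC : 0 < C := h.nonneg.trans_lt hWC
  have hK0 : 0 < K := (mul_pos (Real.exp_pos 1) hC).trans_le hK
  have hl0 : 0 < l := (mul_pos hC hK0).trans_le hl
  set τ : ℝ → ℝ := fun t => σ * Real.exp (-l * t) with hτ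
  have hτ0 : ∀ t, 0 ≤ τ t := fun t => mul_nonneg hσ (Real.exp_pos _).le
  have hτd : ∀ t, HasDerivAt τ (-l * τ t) t := fun t => by
    refine (((hasDerivAt_id t).const_mul (-l)).exp.const_mul σ).congr_deriv ?_
    simp only [hτ, id]
    ring
  have hτanti : Antitone τ := fun s t hst => by
    refine mul_le_mul_of_nonneg_left (Real.exp_le_exp.2 ?_) hσ
    nlinarith
  have hexp0 : ∀ t (k : ℕ), 0 ≤ Real.exp (τ t * (min k N : ℕ)) := fun t k => (Real.exp_pos _).le
  have hexpM : ∀ t (k : ℕ), Real.exp (τ t * (min k N : ℕ)) ≤ Real.exp (τ t * N) := fun t k =>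
    Real.exp_le_exp.2 (mul_le_mul_of_nonneg_left (by exact_mod_cast min_le_right _ _) (hτ0 t))
  have hexpsub : ∀ t (k n m : ℕ), k ≤ n + m → Real.exp (τ t * (min k N : ℕ)) ≤
      Real.exp (τ t * (min n N : ℕ)) * Real.exp (τ t * (min m N : ℕ)) := fun t k n m hk => by
    rw [← Real.exp_add, ← mul_add]
    refine Real.exp_le_exp.2 (mul_le_mul_of_nonneg_left ?_ (hτ0 t))
    have : min k N ≤ min n N + min m N := by omega
    exact_mod_cast this
  set r : ℕ → ℝ → ℝ := fun m t => ∑' k, (if min k N = m then 1 else 0) * ‖u t k‖ with hr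
  have hr0 : ∀ m t, 0 ≤ r m t := fun m t =>
    tsum_nonneg fun k => mul_nonneg (by split_ifs <;> norm_num) (norm_nonneg _)
  have hrc : ∀ m, Continuous (r m) := fun m =>
    h.continuous_tsum_weight (M := 1) (fun k => by split_ifs <;> norm_num)
      (fun k => by split_ifs <;> norm_num)
  have hdecomp : ∀ s t, ∑' k, Real.exp (τ s * (min k N : ℕ)) * ‖u t k‖ =
      ∑ m ∈ Finset.range (N + 1), Real.exp (τ s * m) * r m t := fun s t =>
    tsum_comp_min_mul (h.summable t) (fun _ => norm_nonneg _) N fun m => Real.exp (τ s * m)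
  have hmass : ∀ t, ∑ m ∈ Finset.range (N + 1), r m t ≤ W := fun t => by
    have := tsum_comp_min_mul (h.summable t) (fun _ => norm_nonneg _) N fun _ => 1
    rw [← Finset.sum_congr rfl fun m _ => one_mul (r m t), ← this, tsum_congr fun k => one_mul _]
    exact h.tsum_le t
  set f : ℝ → ℝ := fun t => ∑' k, Real.exp (τ t * (min k N : ℕ)) * ‖u t k‖ with hf
  set Y : ℝ → ℝ := fun t => ∑ m ∈ Finset.range (N + 1), τ t * m * Real.exp (τ t * m) * r m t
    with hY
  have hfc : Continuous f := by
    simp only [hf, hdecomp]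
    have hτc : Continuous τ := continuous_iff_continuousAt.2 fun t => (hτd t).continuousAt
    fun_prop
  have hfY : ∀ t, 2 * f t - Real.exp 1 * W ≤ Y t := fun t => by
    have h1 : 2 * f t - Real.exp 1 * ∑ m ∈ Finset.range (N + 1), r m t ≤ Y t := by
      simp only [hf, hdecomp, hY, Finset.mul_sum]
      rw [← Finset.sum_sub_distrib]
      refine Finset.sum_le_sum fun m _ => ?_
      have := mul_le_mul_of_nonneg_right (two_mul_exp_sub_le (τ t * m)) (hr0 m t)
      linarith
    have := mul_le_mul_of_nonneg_left (hmass t) (Real.exp_pos 1).le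
    linarith
  have hslope : ∀ x, ∀ ρ, -l * Y x + W * f x ^ 2 < ρ →
      ∀ᶠ z in nhdsWithin x (Set.Ioi x), slope f x z < ρ := by
    intro x ρ hρ
    set L := Real.exp (τ x * N) * W ^ 3
    set D : ℝ → ℝ := fun z => ∑ m ∈ Finset.range (N + 1), Real.exp (τ z * m) * r m x with hD
    have hDd : HasDerivAt D (-l * Y x) x := by
      have : HasDerivAt D (∑ m ∈ Finset.range (N + 1),
          Real.exp (τ x * m) * (-l * τ x * m) * r m x) x :=
        HasDerivAt.fun_sum fun m _ => (((hτd x).mul_const (m : ℝ)).exp.mul_const _)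
      convert this using 1
      rw [hY, Finset.mul_sum]
      exact Finset.sum_congr rfl fun m _ => by ring
    have hlim : Filter.Tendsto (fun z => slope D x z + W * (f x + L * (z - x)) ^ 2)
        (nhdsWithin x (Set.Ioi x)) (nhds (-l * Y x + W * f x ^ 2)) := by
      refine (hDd.tendsto_slope.mono_left (nhdsWithin_mono _ fun z hz => ne_of_gt hz)).add ?_
      have : Continuous fun z => W * (f x + L * (z - x)) ^ 2 := by fun_prop
      have h2 := (this.tendsto x).mono_left (nhdsWithin_le_nhds (s := Set.Ioi x))
      rwa [sub_self, mul_zero, add_zero] at h2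
    filter_upwards [hlim.eventually_lt_const hρ, self_mem_nhdsWithin] with z hz hxz
    refine lt_of_le_of_lt ?_ hz
    have hxz' : x < z := hxz
    have hpos : 0 < z - x := sub_pos.2 hxz'
    have hQ : ∀ s ∈ Set.Icc x z,
        ∑' k, Real.exp (τ x * (min k N : ℕ)) * ‖u s k‖ ≤ f x + L * (z - x) := fun s hs => by
      have h1 := le_of_abs_le (h.abs_tsum_weight_sub_le (hexp0 x) (hexpM x) hs.1)
      have hL : 0 ≤ L := mul_nonneg (Real.exp_pos _).le (pow_nonneg h.nonneg 3)
      have h2 := mul_le_mul_of_nonneg_left (sub_le_sub_right hs.2 x) hL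
      simp only [hf]
      linarith
    have hincr := h.tsum_weight_sub_le (hexp0 x) (hexpM x) (hexpsub x) hxz'.le hQ
    have hfz : f z ≤ D z + ∑' k, Real.exp (τ x * (min k N : ℕ)) * ‖u z k - u x k‖ := by
      simp only [hD]
      rw [← hdecomp, ← (h.summable_weight (hexp0 z) (hexpM z) x).tsum_add
        (h.summable_weight_sub (hexp0 x) (hexpM x) x z)]
      refine (h.summable_weight (hexp0 z) (hexpM z) z).tsum_le_tsum (fun k => ?_)
        ((h.summable_weight (hexp0 z) (hexpM z) x).add
          (h.summable_weight_sub (hexp0 x) (hexpM x) x z))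
      have h1 : ‖u z k‖ ≤ ‖u x k‖ + ‖u z k - u x k‖ := by
        simpa using norm_add_le (u x k) (u z k - u x k)
      have h2 : Real.exp (τ z * (min k N : ℕ)) ≤ Real.exp (τ x * (min k N : ℕ)) :=
        Real.exp_le_exp.2 (mul_le_mul_of_nonneg_right (hτanti hxz'.le) (Nat.cast_nonneg _))
      have h3 := mul_le_mul_of_nonneg_left h1 (hexp0 z k)
      have h4 := mul_le_mul_of_nonneg_right h2 (norm_nonneg (u z k - u x k))
      linarith
    have hDx : D x = f x := (hdecomp x x).symm
    rw [slope_def_field, slope_def_field, hDx, div_add' _ _ _ hpos.ne']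
    exact div_le_div_of_nonneg_right (by linarith) hpos.le
  have hmain := image_le_of_liminf_slope_right_lt_deriv_boundary' (f := f)
    (f' := fun x => -l * Y x + W * f x ^ 2) (a := 0) (b := T) (B := fun _ => K) (B' := fun _ => 0)
    hfc.continuousOn (fun x _ ρ hρ => (hslope x ρ hρ).frequently) ?_ continuousOn_const
    (fun x _ => hasDerivWithinAt_const _ _ _) ?_
  · exact hmain (Set.right_mem_Icc.2 hT)
  · refine le_trans (Summable.tsum_le_tsum (fun k => ?_)
      (h.summable_weight (hexp0 0) (hexpM 0) 0) hs0) h0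
    refine mul_le_mul_of_nonneg_right (Real.exp_le_exp.2 ?_) (norm_nonneg _)
    simp only [hτ, mul_zero, Real.exp_zero, mul_one]
    exact mul_le_mul_of_nonneg_left (by exact_mod_cast min_le_left _ _) hσ
  · intro x _ hx
    have h1 : K ≤ Y x := by
      have := hfY x
      nlinarith [Real.exp_pos 1]
    have h2 : C * K * K ≤ l * Y x := mul_le_mul hl h1 hK0.le hl0.le
    have h3 : W * K ^ 2 < C * K ^ 2 := mul_lt_mul_of_pos_right hWC (by positivity)
    simp only [hx]
    linarith

/-- If the Gevrey norm of radius `σ` is initially at most `K`, it stays at most `K` for a radius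
shrinking at any exponential rate `l ≥ C * K`. -/
theorem summable_and_tsum_le (h : IsCubicFlow u v W) {C K l σ : ℝ} (hWC : W < C)
    (hK : Real.exp 1 * C ≤ K) (hl : C * K ≤ l) (hσ : 0 ≤ σ)
    (hs0 : Summable fun k : ℕ => Real.exp (σ * k) * ‖u 0 k‖)
    (h0 : ∑' k : ℕ, Real.exp (σ * k) * ‖u 0 k‖ ≤ K) {T τ : ℝ} (hT : 0 ≤ T)
    (hτ : τ ≤ σ * Real.exp (-l * T)) :
    (Summable fun k : ℕ => Real.exp (τ * k) * ‖u T k‖) ∧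
      ∑' k : ℕ, Real.exp (τ * k) * ‖u T k‖ ≤ K := by
  have hnn : ∀ k : ℕ, 0 ≤ Real.exp (τ * k) * ‖u T k‖ := fun k => by positivity
  have hpart : ∀ n, ∑ k ∈ Finset.range n, Real.exp (τ * k) * ‖u T k‖ ≤ K := fun n => by
    refine le_trans ?_ (h.tsum_truncated_le hWC hK hl hσ hs0 h0 hT n)
    have hs : Summable fun k =>
        Real.exp (σ * Real.exp (-l * T) * (min k n : ℕ)) * ‖u T k‖ :=
      h.summable_weight (M := Real.exp (σ * Real.exp (-l * T) * n))
        (fun _ => (Real.exp_pos _).le) (fun k => Real.exp_le_exp.2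
          (mul_le_mul_of_nonneg_left (by exact_mod_cast min_le_right _ _)
            (mul_nonneg hσ (Real.exp_pos _).le))) T
    refine le_trans (Finset.sum_le_sum fun k hk => ?_)
      (hs.sum_le_tsum (Finset.range n) fun k _ => by positivity)
    rw [min_eq_left (Finset.mem_range.1 hk).le]
    gcongr
  exact ⟨summable_of_sum_range_le hnn hpart, Real.tsum_le_of_sum_range_le hnn hpart⟩

end IsCubicFlow

theorem exp_mul_le_exp_one_add {θ : ℝ} (hθ0 : 0 < θ) (hθ1 : θ ≤ 1) (x : ℝ) :
    Real.exp (θ * x) ≤ Real.exp 1 + Real.exp (1 - θ⁻¹) * Real.exp x := by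
  rcases le_total (θ * x) 1 with hx | hx
  · exact (Real.exp_le_exp.2 hx).trans (le_add_of_nonneg_right (by positivity))
  · have h1 : θ⁻¹ ≤ x := by rwa [inv_le_iff_one_le_mul₀' hθ0]
    rw [← Real.exp_add]
    refine (Real.exp_le_exp.2 ?_).trans (le_add_of_nonneg_left (Real.exp_pos 1).le)
    have h2 := mul_nonneg (sub_nonneg.2 hθ1) (sub_nonneg.2 h1)
    have h3 : θ * θ⁻¹ = 1 := mul_inv_cancel₀ hθ0.ne'
    linarith

/-- Interpolation between the Wiener norm and a Gevrey norm. -/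
theorem summable_and_tsum_exp_mul_le {a : ℕ → ℝ} (ha : ∀ k, 0 ≤ a k) (hs : Summable a) {σ θ : ℝ}
    (hG : Summable fun k : ℕ => Real.exp (σ * k) * a k) (hθ0 : 0 < θ) (hθ1 : θ ≤ 1) :
    (Summable fun k : ℕ => Real.exp (θ * σ * k) * a k) ∧
      ∑' k : ℕ, Real.exp (θ * σ * k) * a k ≤
        Real.exp 1 * ∑' k, a k + Real.exp (1 - θ⁻¹) * ∑' k : ℕ, Real.exp (σ * k) * a k := by
  have hsum := (hs.mul_left (Real.exp 1)).add (hG.mul_left (Real.exp (1 - θ⁻¹)))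
  have hle : ∀ k : ℕ, Real.exp (θ * σ * k) * a k ≤
      Real.exp 1 * a k + Real.exp (1 - θ⁻¹) * (Real.exp (σ * k) * a k) := fun k => by
    have := mul_le_mul_of_nonneg_right (exp_mul_le_exp_one_add hθ0 hθ1 (σ * k)) (ha k)
    rw [mul_assoc θ]
    linarith
  have hsθ := hsum.of_nonneg_of_le (fun k => mul_nonneg (Real.exp_pos _).le (ha k)) hle
  refine ⟨hsθ, (hsθ.tsum_le_tsum hle hsum).trans_eq ?_⟩
  rw [(hs.mul_left _).tsum_add (hG.mul_left _), tsum_mul_left, tsum_mul_left]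

theorem one_le_sqrt_five : 1 ≤ Real.sqrt 5 := Real.one_le_sqrt.2 (by norm_num)

theorem IsCubicFlow.gevrey_le {u v : ℝ → ℕ → ℂ} {W C B σ T : ℝ} (h : IsCubicFlow u v W)
    (hWC : W < C) (hσ : 0 ≤ σ) (hG : Summable fun k : ℕ => Real.exp (σ * k) * ‖u 0 k‖)
    (hB : ∑' k : ℕ, Real.exp (σ * k) * ‖u 0 k‖ ≤ B) (hT : 0 < T) {l : ℝ}
    (hl : l = 2 * C * Real.sqrt (2 * B / (C * T) + 5 * Real.exp 1 ^ 2 * C ^ 2)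
      + 2 * Real.exp 1 * C ^ 2) :
    (Summable fun k : ℕ => Real.exp (σ * Real.exp (-l * T) * k) * ‖u T k‖) ∧
      ∑' k : ℕ, Real.exp (σ * Real.exp (-l * T) * k) * ‖u T k‖ ≤
        max B ((1 + Real.sqrt 5) / 2 * Real.exp 1 * C) := by
  have hC : 0 < C := h.nonneg.trans_lt hWC
  have hB0 : 0 ≤ B := (tsum_nonneg fun k => by positivity).trans hB
  have he : 0 < Real.exp 1 := Real.exp_pos 1
  have h5 := one_le_sqrt_five
  set R := 2 * B / (C * T) + 5 * Real.exp 1 ^ 2 * C ^ 2 with hR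
  have hR0 : 0 ≤ R := by positivity
  have hS : Real.sqrt 5 * (Real.exp 1 * C) ≤ Real.sqrt R := by
    refine Real.le_sqrt_of_sq_le ?_
    rw [mul_pow, Real.sq_sqrt (by norm_num : (0 : ℝ) ≤ 5), hR]
    have : 0 ≤ 2 * B / (C * T) := by positivity
    linarith [mul_pow (Real.exp 1) C 2]
  have hl5 : 2 * (1 + Real.sqrt 5) * Real.exp 1 * C ^ 2 ≤ l := by
    have := mul_le_mul_of_nonneg_left hS (by positivity : 0 ≤ 2 * C)
    rw [hl]
    linarith
  have heC : 0 < Real.exp 1 * C ^ 2 := by positivity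
  have hl4 : 4 * (Real.exp 1 * C ^ 2) ≤ l := by nlinarith
  have hl0 : 0 < l := by linarith
  rcases le_or_gt (C * B) l with hBl | hBl
  · refine h.summable_and_tsum_le hWC ?_ ?_ hσ hG (hB.trans (le_max_left _ _)) hT.le le_rfl
    · refine le_trans ?_ (le_max_right _ _)
      have : 0 < Real.exp 1 * C := by positivity
      nlinarith
    · rw [mul_max_of_nonneg _ _ hC.le]
      refine max_le hBl ?_
      nlinarith
  · have hlsq : 8 * (B * C) ≤ l ^ 2 * T := by
      have h1 : 2 * C * Real.sqrt R ≤ l := by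
        rw [hl]
        linarith
      have h2 : (2 * C * Real.sqrt R) ^ 2 ≤ l ^ 2 := pow_le_pow_left₀ (by positivity) h1 2
      rw [mul_pow, Real.sq_sqrt hR0] at h2
      have h3 : (2 * C) ^ 2 * R * T = 8 * (B * C) + 20 * Real.exp 1 ^ 2 * C ^ 4 * T := by
        rw [hR]
        field_simp
        ring
      have h4 := mul_le_mul_of_nonneg_right h2 hT.le
      have hpos : 0 ≤ 20 * Real.exp 1 ^ 2 * C ^ 4 * T := by positivity
      linarith
    set y := l * T / 2 with hy
    have hy0 : 0 < y := by positivity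
    have hθ1 : Real.exp (-y) ≤ 1 := Real.exp_le_one_iff.2 (by linarith)
    obtain ⟨hsθ, hθ⟩ := summable_and_tsum_exp_mul_le (fun k => norm_nonneg (u 0 k)) (h.summable 0)
      hG (Real.exp_pos (-y)) hθ1
    have hfac : Real.exp (1 - (Real.exp (-y))⁻¹) * (1 + y) ≤ 1 := by
      rw [← Real.exp_neg, neg_neg]
      have h1 : 1 + y ≤ Real.exp (Real.exp y - 1) := by
        linarith [Real.add_one_le_exp y, Real.add_one_le_exp (Real.exp y - 1)]
      refine (mul_le_mul_of_nonneg_left h1 (Real.exp_pos _).le).trans_eq ?_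
      rw [← Real.exp_add]
      simp
    have hBy : B ≤ l / (4 * C) * (1 + y) := by
      have : l / (4 * C) * (1 + y) = l / (4 * C) + l ^ 2 * T / (8 * C) := by
        rw [hy]
        field_simp
        ring
      have h2 : B ≤ l ^ 2 * T / (8 * C) := by
        rw [le_div_iff₀ (by positivity)]
        linarith
      have h3 : 0 < l / (4 * C) := by positivity
      linarith
    have hfacB : Real.exp (1 - (Real.exp (-y))⁻¹) * B ≤ l / (4 * C) := by
      have h1 := mul_le_mul_of_nonneg_left hBy (Real.exp_pos (1 - (Real.exp (-y))⁻¹)).le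
      have h2 := mul_le_mul_of_nonneg_left hfac (by positivity : 0 ≤ l / (4 * C))
      linarith
    have heK : Real.exp 1 * C ≤ l / (4 * C) := by
      rw [le_div_iff₀ (by positivity)]
      linarith
    have hK2 : l / (4 * C) + l / (4 * C) = l / (2 * C) := by
      field_simp
      norm_num
    have hinit : ∑' k : ℕ, Real.exp (Real.exp (-y) * σ * k) * ‖u 0 k‖ ≤ l / (2 * C) := by
      have h1 := mul_le_mul_of_nonneg_left ((h.tsum_le 0).trans hWC.le) he.le
      have h2 := mul_le_mul_of_nonneg_left hB (Real.exp_pos (1 - (Real.exp (-y))⁻¹)).le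
      linarith
    have hKl : C * (l / (2 * C)) ≤ l / 2 := le_of_eq (by field_simp)
    have hτ : σ * Real.exp (-l * T) ≤ Real.exp (-y) * σ * Real.exp (-(l / 2) * T) := by
      rw [mul_comm _ σ, mul_assoc, ← Real.exp_add]
      refine le_of_eq ?_
      rw [hy]
      ring_nf
    obtain ⟨hs, hle⟩ := h.summable_and_tsum_le hWC (by linarith [(by positivity : 0 < l / (4 * C))])
      hKl (by positivity) hsθ hinit hT.le hτ
    refine ⟨hs, (hle.trans ?_).trans (le_max_left _ _)⟩
    rw [div_le_iff₀ (by positivity)]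
    nlinarith

theorem IsSzegoSolution.isCubicFlow {u : ℝ → ℕ → ℂ} {W : ℝ} (hu : IsSzegoSolution u)
    (hs : ∀ t, Summable fun k => ‖u t k‖) (hW : ∀ t, ∑' k, ‖u t k‖ ≤ W) :
    IsCubicFlow u (fun t k => -Complex.I * szegoCubic u t k) W where
  hasDerivAt t k := (hu t k).2
  summable := hs
  tsum_le := hW
  norm_le t k := by
    rw [norm_mul, norm_neg, Complex.norm_I, one_mul]
    refine (norm_tsum_le_tsum_norm (hu t k).1).trans_eq (tsum_congr fun p => ?_)
    rw [norm_mul, norm_mul, RCLike.norm_conj]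

theorem IsCubicFlow.reverse {u v : ℝ → ℕ → ℂ} {W : ℝ} (h : IsCubicFlow u v W) :
    IsCubicFlow (fun t => u (-t)) (fun t k => -v (-t) k) W where
  hasDerivAt t k := by
    have := (h.hasDerivAt (-t) k).scomp t (hasDerivAt_neg t)
    simpa [Function.comp_def] using this
  summable t := h.summable (-t)
  tsum_le t := h.tsum_le (-t)
  norm_le t k := by simpa using h.norm_le (-t) k

theorem tendsto_szego_rate {C B : ℝ} (hC : 0 < C) :
    Filter.Tendsto (fun t : ℝ =>
      2 * C * Real.sqrt (2 * B / (C * |t|) + 5 * Real.exp 1 ^ 2 * C ^ 2) + 2 * Real.exp 1 * C ^ 2)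
      (Filter.cocompact ℝ) (nhds (2 * (1 + Real.sqrt 5) * Real.exp 1 * C ^ 2)) := by
  have habs : Filter.Tendsto (fun t : ℝ => C * |t|) (Filter.cocompact ℝ) Filter.atTop :=
    (tendsto_norm_cocompact_atTop (E := ℝ)).const_mul_atTop hC
  have hlim := ((((habs.const_div_atTop (2 * B)).add_const
    (5 * Real.exp 1 ^ 2 * C ^ 2)).sqrt).const_mul (2 * C)).add_const (2 * Real.exp 1 * C ^ 2)
  have hsqrt : Real.sqrt (0 + 5 * Real.exp 1 ^ 2 * C ^ 2) = Real.sqrt 5 * (Real.exp 1 * C) := by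
    rw [zero_add, mul_assoc, ← mul_pow, Real.sqrt_mul (by norm_num), Real.sqrt_sq (by positivity)]
  rw [hsqrt] at hlim
  convert hlim using 2
  ring

/-- Improved shrinking rate: with `λ̃(t) = 2C₁ √(2B/(C₁|t|) + 5e²C₁²) + 2eC₁²`
and `τ̃(t) = σ e^{-λ̃(t)|t|}`, one has `∑_k e^{τ̃(t) k} |u(t,k)| ≤ C₀` for all `t ≠ 0`;
moreover `λ̃(t) → 2(1+√5) e C₁²` as `|t| → ∞`. -/
theorem szego_gevrey_improved_rate (σ : ℝ) (hσ : 0 < σ) (u : ℝ → ℕ → ℂ)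
    (hu : IsSzegoSolution u) (C₁ B : ℝ) (hC₁ : 0 < C₁)
    (hW : ∀ t : ℝ, Summable fun k : ℕ => ‖u t k‖)
    (hWb : ∀ t : ℝ, (∑' k : ℕ, ‖u t k‖) + 1 ≤ C₁)
    (hG : Summable fun k : ℕ => Real.exp (σ * k) * ‖u 0 k‖)
    (hB : (∑' k : ℕ, Real.exp (σ * k) * ‖u 0 k‖) ≤ B)
    (C₀ : ℝ) (hC₀ : C₀ = max B ((1 + Real.sqrt 5) / 2 * Real.exp 1 * C₁))
    (lam : ℝ → ℝ)
    (hlam : ∀ t : ℝ, t ≠ 0 → lam t =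
      2 * C₁ * Real.sqrt (2 * B / (C₁ * |t|) + 5 * (Real.exp 1) ^ 2 * C₁ ^ 2)
        + 2 * Real.exp 1 * C₁ ^ 2) :
    (∀ t : ℝ, t ≠ 0 →
      (Summable fun k : ℕ => Real.exp (σ * Real.exp (-(lam t) * |t|) * k) * ‖u t k‖) ∧
      (∑' k : ℕ, Real.exp (σ * Real.exp (-(lam t) * |t|) * k) * ‖u t k‖) ≤ C₀) ∧
    Filter.Tendsto lam (Filter.cocompact ℝ)
      (nhds (2 * (1 + Real.sqrt 5) * Real.exp 1 * C₁ ^ 2)) := by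
  have hflow : IsCubicFlow u (fun t k => -Complex.I * szegoCubic u t k) (C₁ - 1) :=
    hu.isCubicFlow hW fun t => le_sub_iff_add_le.2 (hWb t)
  have hWC : C₁ - 1 < C₁ := sub_one_lt C₁
  refine ⟨fun t ht => ?_, ?_⟩
  · subst hC₀
    rcases lt_or_gt_of_ne ht with h | h
    · have hl := hlam t ht
      rw [abs_of_neg h] at hl ⊢
      simpa using hflow.reverse.gevrey_le hWC hσ.le (by simpa using hG) (by simpa using hB)
        (neg_pos.2 h) hl
    · have hl := hlam t ht
      rw [abs_of_pos h] at hl ⊢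
      exact hflow.gevrey_le hWC hσ.le hG hB h hl
  · refine (tendsto_szego_rate (B := B) hC₁).congr' ?_
    filter_upwards [(Set.finite_singleton (0 : ℝ)).isCompact.compl_mem_cocompact] with t ht
    exact (hlam t ht).symm
end
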